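/- arXiv:2502.08032 — 2 statements merged into one kernel-verified Lean document; each statement's English description precedes it below -/
import Mathlib

section
/- Let G=(V,E) be a directed acyclic graph with transitive-closure edge set E^T, let d ≥ 1 and α_D ≥ 3 be integers, and let x: E^T∖E → ℝ_{≥0}. Suppose (s,t)∈E^T and A' ⊆ E^T∖E is an (α_D·d)-critical set of (s,t) with Σ_{e∈A'} x_e < α_D/9. Then there exist a pair (u,v)∈E^T and a set A ⊆ A' such that A is a d-critical set of (u,v) and Σ_{e∈A} x_e < 1. -/
/-- The adjacency relation of a digraph given by its edge set. -/
def digAdj {V : Type*} (E : Set (V × V)) : V → V → Prop := fun u v => (u, v) ∈ E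

/-- Reachability (directed path of length ≥ 0). -/
def digReach {V : Type*} (E : Set (V × V)) : V → V → Prop :=
  Relation.ReflTransGen (digAdj E)

/-- The transitive-closure edge set: pairs joined by a directed path of length ≥ 1. -/
def digTC {V : Type*} (E : Set (V × V)) : Set (V × V) :=
  {p | Relation.TransGen (digAdj E) p.1 p.2}

/-- There is a directed walk of length `n` from `u` to `v`. -/
def hasWalk {V : Type*} (E : Set (V × V)) (u v : V) (n : ℕ) : Prop :=
  ∃ f : ℕ → V, f 0 = u ∧ f n = v ∧ ∀ i < n, (f i, f (i + 1)) ∈ E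

/-- The distance from `u` to `v` (number of edges of a shortest directed path; `⊤` if none). -/
noncomputable def digDist {V : Type*} (E : Set (V × V)) (u v : V) : ℕ∞ :=
  sInf {n : ℕ∞ | ∃ m : ℕ, hasWalk E u v m ∧ n = (m : ℕ∞)}

/-- The graph has diameter at most `d`: every reachable pair is at distance ≤ `d`. -/
def diamLE {V : Type*} (E : Set (V × V)) (d : ℕ) : Prop :=
  ∀ u v : V, (u, v) ∈ digTC E → digDist E u v ≤ (d : ℕ∞)

/-- `E'` is an `(s,d)`-shortcut of the digraph with edge set `E`. -/
def IsShortcut {V : Type*} (E E' : Set (V × V)) (s d : ℕ) : Prop :=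
  E' ⊆ digTC E \ E ∧ E'.ncard ≤ s ∧ diamLE (E ∪ E') d

/-- `E''` is an `(s,d)`-TC spanner of the digraph with edge set `E`. -/
def IsTCSpanner {V : Type*} (E E'' : Set (V × V)) (s d : ℕ) : Prop :=
  E'' ⊆ digTC E ∧ E''.ncard ≤ s ∧ digTC E'' = digTC E ∧ diamLE E'' d

/-- A digraph is acyclic if no vertex lies on a directed cycle. -/
def digAcyclic {V : Type*} (E : Set (V × V)) : Prop :=
  ∀ v : V, ¬ Relation.TransGen (digAdj E) v v

/-- The set of vertices lying on some directed path from `u` to `v`. -/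
def digBetween {V : Type*} (E : Set (V × V)) (u v : V) : Set V :=
  {w | digReach E u w ∧ digReach E w v}

/-- `A ⊆ E^T` is a `k`-critical set of the pair `(u,v)` if the graph `(V, E^T∖A)` contains
no directed path of length at most `k` from `u` to `v`. -/
def IsCritical {V : Type*} (E : Set (V × V)) (k : ℕ) (u v : V) (A : Set (V × V)) : Prop :=
  A ⊆ digTC E ∧ ¬ digDist (digTC E \ A) u v ≤ (k : ℕ∞)

theorem hasWalk.trans {V : Type*} {F : Set (V × V)} {u v w : V} {m n : ℕ}
    (h₁ : hasWalk F u v m) (h₂ : hasWalk F v w n) : hasWalk F u w (m + n) := by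
  obtain ⟨f, hf0, hfm, hf⟩ := h₁
  obtain ⟨g, hg0, hgn, hg⟩ := h₂
  refine ⟨fun i => if i ≤ m then f i else g (i - m), by simp [hf0], ?_, fun i hi => ?_⟩
  · rcases Nat.eq_zero_or_pos n with rfl | hn
    · simp [hfm, ← hgn, hg0]
    · simp [hn.ne', hgn]
  · rcases lt_trichotomy i m with h | rfl | h
    · simpa [h.le, Nat.succ_le_of_lt h] using hf i h
    · simpa [hfm, hg0] using hg 0 (by omega)
    · have := hg (i - m) (by omega)
      simpa [h.not_ge, show ¬ i + 1 ≤ m by omega, show i + 1 - m = i - m + 1 by omega] using this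

theorem hasWalk_zero {V : Type*} (F : Set (V × V)) (u : V) : hasWalk F u u 0 :=
  ⟨fun _ => u, rfl, rfl, by simp⟩

theorem hasWalk_one {V : Type*} {F : Set (V × V)} {u v : V} (h : (u, v) ∈ F) :
    hasWalk F u v 1 :=
  ⟨fun i => if i = 0 then u else v, by simp, by simp, fun i hi => by
    obtain rfl : i = 0 := by omega
    simpa using h⟩

theorem digDist_le_iff {V : Type*} {F : Set (V × V)} {u v : V} {k : ℕ} :
    digDist F u v ≤ (k : ℕ∞) ↔ ∃ m ≤ k, hasWalk F u v m := by
  constructor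
  · intro h
    have hlt : digDist F u v < ((k + 1 : ℕ) : ℕ∞) :=
      h.trans_lt (by exact_mod_cast Nat.lt_succ_self k)
    obtain ⟨_, ⟨m, hm, rfl⟩, hlt⟩ := sInf_lt_iff.1 hlt
    exact ⟨m, Nat.lt_succ_iff.1 (by exact_mod_cast hlt), hm⟩
  · rintro ⟨m, hmk, hm⟩
    have hle : digDist F u v ≤ (m : ℕ∞) := sInf_le ⟨m, hm, rfl⟩
    exact hle.trans (by exact_mod_cast hmk)

/-- The edges of `A` lying on some directed walk of `E` from `u` to `v`. -/
def edgesBetween {V : Type*} (E A : Set (V × V)) (u v : V) : Set (V × V) :=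
  {e ∈ A | digReach E u e.1 ∧ digReach E e.2 v}

theorem hasWalk_diff_of_diff_edgesBetween {V : Type*} {E A : Set (V × V)} {u v : V} {n : ℕ}
    (h : hasWalk (digTC E \ edgesBetween E A u v) u v n) : hasWalk (digTC E \ A) u v n := by
  obtain ⟨f, rfl, rfl, hf⟩ := h
  have hreach : ∀ i ≤ n, ∀ j ≤ i, digReach E (f j) (f i) := by
    intro i hi j hj
    induction i, hj using Nat.le_induction with
    | base => exact Relation.ReflTransGen.refl
    | succ i _ ih =>
      exact (ih (by omega)).trans (Relation.TransGen.to_reflTransGen (hf i (by omega)).1)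
  exact ⟨f, rfl, rfl, fun i hi => ⟨(hf i hi).1, fun hA => (hf i hi).2
    ⟨hA, hreach i hi.le 0 (Nat.zero_le i), hreach n le_rfl (i + 1) hi⟩⟩⟩

theorem finsum_mem_add_le_of_disjoint {α : Type*} {x : α → ℝ} (hx : ∀ a, 0 ≤ x a)
    {S₁ S₂ T : Set α} (hT : (T ∩ Function.support x).Finite) (h₁ : S₁ ⊆ T) (h₂ : S₂ ⊆ T)
    (hdisj : Disjoint S₁ S₂) :
    ∑ᶠ a ∈ S₁, x a + ∑ᶠ a ∈ S₂, x a ≤ ∑ᶠ a ∈ T, x a := by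
  rw [← finsum_mem_union' hdisj (hT.subset (Set.inter_subset_inter_left _ h₁))
    (hT.subset (Set.inter_subset_inter_left _ h₂)),
    ← finsum_mem_add_sdiff' (Set.union_subset h₁ h₂) hT]
  exact le_add_of_nonneg_right (finsum_nonneg fun a => finsum_nonneg fun _ => hx a)

theorem finsum_edgesBetween_add_le {V : Type*} {E A : Set (V × V)} (hacyc : digAcyclic E)
    (hA : A ⊆ digTC E) {x : V × V → ℝ} (hx : ∀ e, 0 ≤ x e)
    (hfin : (A ∩ Function.support x).Finite) {u v w : V}
    (huv : digReach E u v) (hvw : digReach E v w) :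
    ∑ᶠ e ∈ edgesBetween E A u v, x e + ∑ᶠ e ∈ edgesBetween E A v w, x e ≤
      ∑ᶠ e ∈ edgesBetween E A u w, x e := by
  refine finsum_mem_add_le_of_disjoint hx
    (hfin.subset (Set.inter_subset_inter_left _ (Set.sep_subset _ _))) ?_ ?_ ?_
  · exact fun e he => ⟨he.1, he.2.1, he.2.2.trans hvw⟩
  · exact fun e he => ⟨he.1, huv.trans he.2.1, he.2.2⟩
  · refine Set.disjoint_left.2 fun e he he' => hacyc v ?_
    have hcycle : Relation.TransGen (digAdj E) e.1 e.2 := hA he.1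
    exact (Relation.TransGen.trans_right he'.2.1 hcycle).trans_left he.2.2

/-- If every pair between which `A` has weight less than one is joined by a walk of length at
most `d` avoiding `A`, then every reachable pair splits into a part with a walk whose length is
at most `d + 1` times the weight of that part, and a part of weight less than one. -/
theorem exists_hasWalk_le_finsum_edgesBetween {V : Type*} {E A : Set (V × V)}
    (hacyc : digAcyclic E) (hA : A ⊆ digTC E \ E) {x : V × V → ℝ} (hx : ∀ e, 0 ≤ x e)
    (hfin : (A ∩ Function.support x).Finite) {d : ℕ}
    (hwalk : ∀ u v, digReach E u v → ∑ᶠ e ∈ edgesBetween E A u v, x e < 1 →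
      ∃ n ≤ d, hasWalk (digTC E \ A) u v n)
    {u v : V} (huv : digReach E u v) :
    ∃ w, digReach E u w ∧ digReach E w v ∧ ∑ᶠ e ∈ edgesBetween E A w v, x e < 1 ∧
      ∃ n : ℕ, hasWalk (digTC E \ A) u w n ∧
        (n : ℝ) ≤ (∑ᶠ e ∈ edgesBetween E A u w, x e) * (d + 1) := by
  have hTC : A ⊆ digTC E := hA.trans Set.sdiff_subset
  have hself (z : V) : ∑ᶠ e ∈ edgesBetween E A z z, x e ≤ 0 := by
    have hzz : digReach E z z := Relation.ReflTransGen.refl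
    linarith [finsum_edgesBetween_add_le hacyc hTC hx hfin hzz hzz]
  induction huv with
  | refl =>
    refine ⟨u, .refl, .refl, (hself u).trans_lt one_pos, 0, hasWalk_zero _ _, ?_⟩
    rw [Nat.cast_zero]
    exact mul_nonneg (finsum_nonneg fun e => finsum_nonneg fun _ => hx e) (by positivity)
  | @tail v v' huv hstep ih =>
    obtain ⟨w, huw, hwv, hlt, n, hn, hle⟩ := ih
    have hwv' : digReach E w v' := hwv.tail hstep
    by_cases hlt' : ∑ᶠ e ∈ edgesBetween E A w v', x e < 1
    · exact ⟨w, huw, hwv', hlt', n, hn, hle⟩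
    · obtain ⟨m, hmd, hm⟩ := hwalk w v hwv hlt
      have hedge : (v, v') ∈ digTC E \ A :=
        ⟨Relation.TransGen.single hstep, fun h => (hA h).2 hstep⟩
      refine ⟨v', huw.trans hwv', .refl, (hself v').trans_lt one_pos, n + m + 1,
        (hn.trans hm).trans (hasWalk_one hedge), ?_⟩
      have hadd := finsum_edgesBetween_add_le hacyc hTC hx hfin huw hwv'
      have hmd' : (m : ℝ) ≤ d := by exact_mod_cast hmd
      push_cast
      nlinarith [not_lt.1 hlt']

/-- Critical-set decomposition. For a DAG `G=(V,E)`, integers `d ≥ 1`,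
`α_D ≥ 3`, nonnegative weights `x`, and an `(α_D·d)`-critical set `A' ⊆ E^T∖E` of a
reachable pair `(s,t)` with `Σ_{e∈A'} x_e < α_D/9`, there is a reachable pair `(u,v)` and a
subset `A ⊆ A'` that is `d`-critical for `(u,v)` with `Σ_{e∈A} x_e < 1`. -/
theorem stmt_12 {V : Type*} (E : Set (V × V)) (hsimple : ∀ v : V, (v, v) ∉ E)
    (hacyc : digAcyclic E)
    (d αD : ℕ) (hd : 1 ≤ d) (hαD : 3 ≤ αD)
    (x : V × V → ℝ) (hx : ∀ e, 0 ≤ x e)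
    (s t : V) (hst : (s, t) ∈ digTC E)
    (A' : Set (V × V)) (hA' : A' ⊆ digTC E \ E)
    (hcrit : IsCritical E (αD * d) s t A')
    (hsum : ∑ᶠ e ∈ A', x e < (αD : ℝ) / 9) :
    ∃ u v : V, (u, v) ∈ digTC E ∧
      ∃ A ⊆ A', IsCritical E d u v A ∧ ∑ᶠ e ∈ A, x e < 1 := by
  by_cases hfin : (A' ∩ Function.support x).Finite
  · by_contra! hno
    have hTC : A' ⊆ digTC E := hA'.trans Set.sdiff_subset
    have hwalk : ∀ u v, digReach E u v → ∑ᶠ e ∈ edgesBetween E A' u v, x e < 1 →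
        ∃ n ≤ d, hasWalk (digTC E \ A') u v n := by
      intro u v huv hlt
      rcases Relation.reflTransGen_iff_eq_or_transGen.1 huv with rfl | huv'
      · exact ⟨0, Nat.zero_le d, hasWalk_zero _ _⟩
      · have hsub : edgesBetween E A' u v ⊆ A' := Set.sep_subset _ _
        by_contra hcon
        refine (hno u v huv' _ hsub ⟨hsub.trans hTC, fun hdist => hcon ?_⟩).not_gt hlt
        obtain ⟨n, hnd, hn⟩ := digDist_le_iff.1 hdist
        exact ⟨n, hnd, hasWalk_diff_of_diff_edgesBetween hn⟩
    obtain ⟨w, hsw, hwt, hlt, n, hn, hle⟩ := exists_hasWalk_le_finsum_edgesBetween hacyc hA' hx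
      hfin hwalk (Relation.TransGen.to_reflTransGen hst)
    obtain ⟨m, hmd, hm⟩ := hwalk w t hwt hlt
    refine hcrit.2 (digDist_le_iff.2 ⟨n + m, ?_, hn.trans hm⟩)
    have hW := finsum_mem_add_le_of_disjoint hx hfin
      (Set.sep_subset A' fun e => digReach E s e.1 ∧ digReach E e.2 w)
      (Set.empty_subset A') (Set.disjoint_empty _)
    rw [finsum_mem_empty, add_zero] at hW
    have hW' : ∑ᶠ e ∈ edgesBetween E A' s w, x e ≤ (αD : ℝ) / 9 := hW.trans hsum.le
    have hd' : (1 : ℝ) ≤ d := by exact_mod_cast hd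
    have hα : (3 : ℝ) ≤ αD := by exact_mod_cast hαD
    have hmd' : (m : ℝ) ≤ d := by exact_mod_cast hmd
    have hn' : (n : ℝ) ≤ (αD : ℝ) / 9 * (d + 1) :=
      hle.trans (mul_le_mul_of_nonneg_right hW' (by positivity))
    have : (n : ℝ) + m ≤ αD * d := by nlinarith
    exact_mod_cast this
  · refine ⟨s, t, hst, A', subset_rfl, ⟨hcrit.1, fun h => hcrit.2 (h.trans ?_)⟩, ?_⟩
    · exact_mod_cast Nat.le_mul_of_pos_left d (by omega)
    · rw [finsum_mem_eq_zero_of_infinite hfin]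
      exact one_pos
end

section
/- There is a universal constant C such that the following holds for every n-vertex digraph G=(V,E) with n ≥ 2, all integers s ≥ n, d ≥ 1, α_D ≥ 1, and every real number α_S with α_S ≥ C·n·(log n)²/√(s·d²·α_D³): if G admits an (s,d)-shortcut, then there exists a set E' ⊆ E^T∖E with |E'| ≤ α_S·s such that the graph (V, E∪E') has diameter at most α_D·d. -/
section Walks

variable {V : Type*} {E H : Set (V × V)} {u v w : V}

theorem hasWalk_zero_s14 : hasWalk E u v 0 ↔ u = v := by
  constructor
  · rintro ⟨f, rfl, rfl, -⟩
    rfl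
  · rintro rfl
    exact ⟨fun _ => u, rfl, rfl, by simp⟩

theorem hasWalk_succ {n : ℕ} :
    hasWalk E u v (n + 1) ↔ ∃ w, hasWalk E u w n ∧ (w, v) ∈ E := by
  constructor
  · rintro ⟨f, rfl, rfl, hf⟩
    exact ⟨f n, ⟨f, rfl, rfl, fun i hi => hf i (by omega)⟩, hf n (by omega)⟩
  · rintro ⟨w, ⟨f, rfl, rfl, hf⟩, h⟩
    refine ⟨fun i => if i ≤ n then f i else v, by simp, by simp, fun i hi => ?_⟩
    rcases Nat.lt_succ_iff_lt_or_eq.1 hi with hi | rfl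
    · have h1 : i ≤ n := by omega
      have h2 : i + 1 ≤ n := by omega
      simpa [h1, h2] using hf i hi
    · simpa using h

theorem hasWalk_one_s14 : hasWalk E u v 1 ↔ (u, v) ∈ E := by
  simp [hasWalk_succ (n := 0), hasWalk_zero_s14]

theorem hasWalk_add {a b : ℕ} :
    hasWalk E u v (a + b) ↔ ∃ w, hasWalk E u w a ∧ hasWalk E w v b := by
  induction b generalizing v with
  | zero => simp [hasWalk_zero_s14]
  | succ b ih =>
    rw [← add_assoc]
    simp only [hasWalk_succ, ih]
    grind

theorem hasWalk.mono {n : ℕ} (h : hasWalk E u v n) (hEH : E ⊆ H) : hasWalk H u v n := by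
  obtain ⟨f, h0, hn, hf⟩ := h
  exact ⟨f, h0, hn, fun i hi => hEH (hf i hi)⟩

theorem digReach_iff_exists_hasWalk : digReach E u v ↔ ∃ n, hasWalk E u v n := by
  constructor
  · intro h
    induction h with
    | refl => exact ⟨0, hasWalk_zero_s14.2 rfl⟩
    | tail _ h ih =>
      obtain ⟨n, hn⟩ := ih
      exact ⟨n + 1, hasWalk_succ.2 ⟨_, hn, h⟩⟩
  · rintro ⟨n, hn⟩
    induction n generalizing v with
    | zero => rw [hasWalk_zero_s14.1 hn]; exact Relation.ReflTransGen.refl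
    | succ n ih =>
      obtain ⟨w, hw, h⟩ := hasWalk_succ.1 hn
      exact Relation.ReflTransGen.tail (ih hw) h

theorem hasWalk.digReach {n : ℕ} (h : hasWalk E u v n) : digReach E u v :=
  digReach_iff_exists_hasWalk.2 ⟨n, h⟩

theorem digReach_refl (E : Set (V × V)) (u : V) : digReach E u u :=
  Relation.ReflTransGen.refl

theorem digReach.trans (h : digReach E u v) (h' : digReach E v w) : digReach E u w :=
  Relation.ReflTransGen.trans h h'

theorem digReach.eq_or_mem_digTC (h : digReach E u v) : u = v ∨ (u, v) ∈ digTC E := by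
  rcases Relation.reflTransGen_iff_eq_or_transGen.1 h with h | h
  · exact Or.inl h.symm
  · exact Or.inr h

theorem digReach_of_mem_digTC (h : (u, v) ∈ digTC E) : digReach E u v :=
  Relation.TransGen.to_reflTransGen h

theorem digReach.of_union (h : digReach (E ∪ H) u v) (hH : H ⊆ digTC E) : digReach E u v := by
  induction h with
  | refl => exact digReach_refl E u
  | tail _ h ih =>
    rcases h with h | h
    · exact Relation.ReflTransGen.tail ih h
    · exact ih.trans (digReach_of_mem_digTC (hH h))

theorem digReach.union (h : digReach E u v) : digReach (E ∪ H) u v := by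
  obtain ⟨n, hn⟩ := digReach_iff_exists_hasWalk.1 h
  exact (hn.mono Set.subset_union_left).digReach

/-- The length of a shortest walk from `u` to `v` (`0` if there is none). -/
noncomputable def walkDist (E : Set (V × V)) (u v : V) : ℕ :=
  sInf {m | hasWalk E u v m}

theorem digReach.hasWalk_walkDist (h : digReach E u v) : hasWalk E u v (walkDist E u v) :=
  Nat.sInf_mem (digReach_iff_exists_hasWalk.1 h)

theorem hasWalk.walkDist_le {n : ℕ} (h : hasWalk E u v n) : walkDist E u v ≤ n :=
  Nat.sInf_le h

theorem walkDist_triangle (h : digReach E u w) (h' : digReach E w v) :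
    walkDist E u v ≤ walkDist E u w + walkDist E w v :=
  (hasWalk_add.2 ⟨w, h.hasWalk_walkDist, h'.hasWalk_walkDist⟩).walkDist_le

theorem digReach.walkDist_anti (h : digReach E u v) (hEH : E ⊆ H) :
    walkDist H u v ≤ walkDist E u v :=
  (h.hasWalk_walkDist.mono hEH).walkDist_le

theorem digReach.exists_between (h : digReach E u v) {t : ℕ} (ht : t ≤ walkDist E u v) :
    ∃ w, digReach E u w ∧ digReach E w v ∧ walkDist E u w = t ∧
      t + walkDist E w v = walkDist E u v := by
  have hw := h.hasWalk_walkDist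
  rw [← Nat.add_sub_of_le ht, hasWalk_add] at hw
  obtain ⟨w, h1, h2⟩ := hw
  have := walkDist_triangle h1.digReach h2.digReach
  have := h1.walkDist_le
  have := h2.walkDist_le
  exact ⟨w, h1.digReach, h2.digReach, by omega, by omega⟩

/-- At least `t` vertices, other than `u`, lie within distance `t` of `u` on the way to a vertex
at distance `t`. -/
theorem digReach.le_card_between [Fintype V] (h : digReach E u v) :
    ∃ A : Finset V, walkDist E u v ≤ A.card ∧ ∀ z ∈ A, digReach E u z ∧ digReach E z v ∧
      1 ≤ walkDist E u z ∧ walkDist E u z + walkDist E z v = walkDist E u v := by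
  classical
  refine ⟨Finset.univ.filter fun z => digReach E u z ∧ digReach E z v ∧ 1 ≤ walkDist E u z ∧
    walkDist E u z + walkDist E z v = walkDist E u v, ?_, by simp⟩
  calc walkDist E u v = (Finset.Icc 1 (walkDist E u v)).card := by simp
    _ ≤ (Finset.image (walkDist E u) _).card := Finset.card_le_card ?_
    _ ≤ _ := Finset.card_image_le
  intro t ht
  rw [Finset.mem_Icc] at ht
  obtain ⟨w, h1, h2, h3, h4⟩ := h.exists_between ht.2
  simp only [Finset.mem_image, Finset.mem_filter, Finset.mem_univ, true_and]
  exact ⟨w, ⟨h1, h2, by omega, by omega⟩, h3⟩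

theorem digReach.walkDist_lt_card [Fintype V] (h : digReach E u v) :
    walkDist E u v < Fintype.card V := by
  obtain ⟨A, hA, hA'⟩ := h.le_card_between
  refine hA.trans_lt (Finset.card_lt_univ_of_notMem (x := u) fun hu => ?_)
  have h1 := (hA' u hu).2.2.1
  have h0 : walkDist E u u ≤ 0 := (hasWalk_zero_s14.2 rfl).walkDist_le
  omega

theorem diamLE_of_hasWalk {d : ℕ}
    (h : ∀ u v, digReach E u v → ∃ m ≤ d, hasWalk E u v m) : diamLE E d := by
  intro u v huv
  obtain ⟨m, hm, hw⟩ := h u v (digReach_of_mem_digTC huv)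
  have hle : digDist E u v ≤ (m : ℕ∞) := sInf_le ⟨m, hw, rfl⟩
  exact hle.trans (by exact_mod_cast hm)

end Walks

section Hitting

theorem exists_greedy_hitting {ι U : Type*} [Fintype U] [DecidableEq U] [Nonempty U]
    (I : Finset ι) (A : ι → Finset U) (a : ℕ) (hA : ∀ i ∈ I, a ≤ (A i).card) (t : ℕ) :
    ∃ T : Finset U, T.card ≤ t ∧
      (({i ∈ I | Disjoint (A i) T}.card : ℕ) : ℝ) ≤
        I.card * (1 - (a : ℝ) / Fintype.card U) ^ t := by
  induction t with
  | zero => exact ⟨∅, by simp⟩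
  | succ t ih =>
    obtain ⟨T, hT, hcard⟩ := ih
    set R : Finset ι := {i ∈ I | Disjoint (A i) T} with hR
    have hm : (0 : ℝ) < Fintype.card U := by exact_mod_cast Fintype.card_pos
    have hsum : R.card * a ≤ ∑ x : U, {i ∈ R | x ∈ A i}.card := by
      rw [show ∑ x : U, {i ∈ R | x ∈ A i}.card = ∑ i ∈ R, _ from Finset.sum_card_bipartiteAbove_eq_sum_card_bipartiteBelow (fun x i => x ∈ A i)]
      rw [← smul_eq_mul]
      refine Finset.card_nsmul_le_sum _ _ _ fun i hi => ?_
      refine (hA i (Finset.mem_filter.1 hi).1).trans (Finset.card_le_card fun x hx => ?_)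
      simpa [Finset.bipartiteBelow] using hx
    obtain ⟨x, -, hx⟩ : ∃ x ∈ (Finset.univ : Finset U),
        (R.card : ℝ) * a / Fintype.card U ≤ ({i ∈ R | x ∈ A i}.card : ℝ) := by
      refine Finset.exists_le_of_sum_le Finset.univ_nonempty ?_
      rw [Finset.sum_const, nsmul_eq_mul, Finset.card_univ, mul_div_cancel₀ _ hm.ne']
      exact_mod_cast hsum
    refine ⟨insert x T, (Finset.card_insert_le x T).trans (by omega), ?_⟩
    have hsplit := Finset.card_filter_add_card_filter_not (s := R) (fun i => x ∈ A i)
    have hsub : {i ∈ I | Disjoint (A i) (insert x T)} = {i ∈ R | x ∉ A i} := by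
      ext i
      simp only [hR, Finset.mem_filter, Finset.disjoint_insert_right]
      tauto
    rw [hsub]
    have h1 : (({i ∈ R | x ∉ A i}.card : ℕ) : ℝ) = R.card - ({i ∈ R | x ∈ A i}.card : ℝ) := by
      rw [← hsplit]; push_cast; ring
    rw [h1]
    rcases I.eq_empty_or_nonempty with hI | ⟨i, hi⟩
    · have : R = ∅ := by simp [hR, hI]
      simp [this, hI]
    have h2 : (0 : ℝ) ≤ 1 - (a : ℝ) / Fintype.card U := by
      rw [sub_nonneg, div_le_one hm]
      exact_mod_cast (hA i hi).trans (Finset.card_le_univ _)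
    calc (R.card : ℝ) - ({i ∈ R | x ∈ A i}.card : ℝ)
        ≤ R.card * (1 - (a : ℝ) / Fintype.card U) := by
          rw [mul_sub, mul_one, ← mul_div_assoc]; linarith
      _ ≤ I.card * (1 - (a : ℝ) / Fintype.card U) ^ t * (1 - (a : ℝ) / Fintype.card U) := by
          gcongr
      _ = _ := by ring

/-- A family of at most `2 ^ b` subsets of `U`, each with at least `a` elements, has a hitting set
of size at most `2 b |U| / a`. -/
theorem exists_hitting {ι U : Type*} [Fintype U] [DecidableEq U]
    (I : Finset ι) (A : ι → Finset U) {a b : ℕ} (ha : 1 ≤ a) (hb : 1 ≤ b)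
    (hI : I.card ≤ 2 ^ b) (hA : ∀ i ∈ I, a ≤ (A i).card) :
    ∃ T : Finset U, (∀ i ∈ I, ∃ x ∈ A i, x ∈ T) ∧ T.card * a ≤ 2 * b * Fintype.card U := by
  rcases I.eq_empty_or_nonempty with rfl | ⟨i₀, hi₀⟩
  · exact ⟨∅, by simp⟩
  have ham : a ≤ Fintype.card U := (hA i₀ hi₀).trans (Finset.card_le_univ _)
  have hm : (0 : ℝ) < Fintype.card U := by exact_mod_cast ha.trans ham
  have ha' : (0 : ℝ) < a := by exact_mod_cast ha
  have : Nonempty U := Fintype.card_pos_iff.1 (by omega)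
  set t := ⌈(b : ℝ) * Fintype.card U / a⌉₊ with ht
  obtain ⟨T, hT, hcard⟩ := exists_greedy_hitting I A a hA t
  have htl : (b : ℝ) * Fintype.card U / a ≤ t := Nat.le_ceil _
  have htu : (t : ℝ) < (b : ℝ) * Fintype.card U / a + 1 := Nat.ceil_lt_add_one (by positivity)
  refine ⟨T, ?_, ?_⟩
  · have hlt : (({i ∈ I | Disjoint (A i) T}.card : ℕ) : ℝ) < 1 := by
      have h0 : (0 : ℝ) ≤ 1 - (a : ℝ) / Fintype.card U := by
        rw [sub_nonneg, div_le_one hm]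
        exact_mod_cast ham
      have h1 : (1 - (a : ℝ) / Fintype.card U) ^ t ≤ Real.exp (-b) := by
        calc (1 - (a : ℝ) / Fintype.card U) ^ t
            ≤ Real.exp (-((a : ℝ) / Fintype.card U)) ^ t :=
              pow_le_pow_left₀ h0 (Real.one_sub_le_exp_neg _) _
          _ = Real.exp (t * -((a : ℝ) / Fintype.card U)) := by rw [Real.exp_nat_mul]
          _ ≤ Real.exp (-b) := by
              rw [Real.exp_le_exp]
              rw [div_le_iff₀ ha'] at htl
              rw [mul_neg, neg_le_neg_iff, ← mul_div_assoc, le_div_iff₀ hm]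
              exact htl
      have h2 : (I.card : ℝ) ≤ 2 ^ b := by exact_mod_cast hI
      have h3 : (2 : ℝ) ^ b < Real.exp b := by
        rw [← Real.exp_one_pow]
        exact pow_lt_pow_left₀ (by linarith [Real.exp_one_gt_d9]) (by norm_num) (by omega)
      calc _ ≤ _ := hcard
        _ ≤ 2 ^ b * Real.exp (-b) := by gcongr
        _ < Real.exp b * Real.exp (-b) := by gcongr
        _ = 1 := by rw [← Real.exp_add]; simp
    have h0 : {i ∈ I | Disjoint (A i) T} = ∅ := by
      rw [← Finset.card_eq_zero]
      exact_mod_cast Nat.lt_one_iff.1 (by exact_mod_cast hlt)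
    intro i hi
    have : ¬ Disjoint (A i) T := fun h => by
      have : i ∈ ({i ∈ I | Disjoint (A i) T} : Finset ι) := Finset.mem_filter.2 ⟨hi, h⟩
      simp [h0] at this
    exact Finset.not_disjoint_iff.1 this
  · have h1 : (T.card : ℝ) * a ≤ b * Fintype.card U + a := by
      calc (T.card : ℝ) * a ≤ (b * Fintype.card U / a + 1) * a := by
            gcongr
            exact (by exact_mod_cast hT : (T.card : ℝ) ≤ t).trans htu.le
        _ = _ := by field_simp
    have h2 : T.card * a ≤ b * Fintype.card U + a := by exact_mod_cast h1
    nlinarith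

end Hitting

section Landmarks

variable {V : Type*} {E F : Set (V × V)} {S : Set V} {k : ℕ}

/-- If `S` hits the geodesics of length `k` of `E`, and the edges of `F` end in `S`, then `S` hits
the geodesics of length `k` of `E ∪ F`. -/
theorem exists_mem_between_of_union (hF : F ⊆ digTC E) (hFS : ∀ p ∈ F, p.2 ∈ S)
    (hS : ∀ x y, digReach E x y → walkDist E x y = k → ∃ z ∈ S, digReach E x z ∧ digReach E z y ∧
      1 ≤ walkDist E x z ∧ walkDist E x z + walkDist E z y = k)
    {x y : V} (hxy : hasWalk (E ∪ F) x y k) (hk : walkDist (E ∪ F) x y = k) :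
    ∃ z ∈ S, digReach E x z ∧ digReach E z y ∧
      1 ≤ walkDist (E ∪ F) x z ∧ walkDist (E ∪ F) x z + walkDist (E ∪ F) z y = k := by
  obtain ⟨f, h0, hfk, hf⟩ := hxy
  by_cases hall : ∀ i < k, (f i, f (i + 1)) ∈ E
  · have hw : hasWalk E x y k := ⟨f, h0, hfk, hall⟩
    have h1 := hw.walkDist_le
    have h2 := hw.digReach.walkDist_anti (Set.subset_union_left (t := F))
    obtain ⟨z, hz, hxz, hzy, h3, h4⟩ := hS x y hw.digReach (by omega)
    have h5 := hxz.walkDist_anti (Set.subset_union_left (t := F))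
    have h6 := hzy.walkDist_anti (Set.subset_union_left (t := F))
    have h7 := walkDist_triangle (hxz.union (H := F)) (hzy.union (H := F))
    exact ⟨z, hz, hxz, hzy, by omega, by omega⟩
  · push Not at hall
    obtain ⟨i, hi, hiE⟩ := hall
    have hiF : (f i, f (i + 1)) ∈ F := (hf i hi).resolve_left hiE
    have h1 : hasWalk (E ∪ F) x (f (i + 1)) (i + 1) :=
      ⟨f, h0, rfl, fun j hj => hf j (by omega)⟩
    have h2 : hasWalk (E ∪ F) (f (i + 1)) y (k - (i + 1)) :=
      ⟨fun j => f (i + 1 + j), rfl, by simp only [← hfk]; congr 1; omega,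
        fun j hj => hf (i + 1 + j) (by omega)⟩
    have h3 := h1.walkDist_le
    have h4 := h2.walkDist_le
    have h5 := walkDist_triangle h1.digReach h2.digReach
    exact ⟨f (i + 1), hFS _ hiF, h1.digReach.of_union hF, h2.digReach.of_union hF, by omega, by omega⟩

/-- A geodesic of length `r * k` of `E ∪ F` passes through `r` vertices of `S` in succession. -/
theorem exists_landmarks (hF : F ⊆ digTC E) (hFS : ∀ p ∈ F, p.2 ∈ S)
    (hS : ∀ x y, digReach E x y → walkDist E x y = k → ∃ z ∈ S, digReach E x z ∧ digReach E z y ∧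
      1 ≤ walkDist E x z ∧ walkDist E x z + walkDist E z y = k)
    {u v : V} {r : ℕ} (huv : digReach (E ∪ F) u v) (hr : walkDist (E ∪ F) u v = r * k) :
    ∃ z : Fin r → V, (∀ i, z i ∈ S) ∧ (∀ i j, i ≤ j → digReach E (z i) (z j)) ∧
      (∀ i, digReach E u (z i)) ∧ (∀ i, digReach E (z i) v) ∧
      (∀ i, walkDist (E ∪ F) (z i) v ≤ r * k) ∧
      StrictMono fun i => walkDist (E ∪ F) u (z i) := by
  obtain ⟨f, h0, hfr, hf⟩ := huv.hasWalk_walkDist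
  rw [hr] at hfr hf
  have hwalk : ∀ a b, a ≤ b → b ≤ r * k → hasWalk (E ∪ F) (f a) (f b) (b - a) := by
    intro a b hab hb
    exact ⟨fun j => f (a + j), rfl, by simp only; congr 1; omega,
      fun j hj => hf (a + j) (by omega)⟩
  have hreach : ∀ a b, a ≤ b → b ≤ r * k → digReach E (f a) (f b) := fun a b hab hb =>
    (hwalk a b hab hb).digReach.of_union hF
  have hdist : ∀ a b, a ≤ b → b ≤ r * k → walkDist (E ∪ F) (f a) (f b) = b - a := by
    intro a b hab hb
    have h1 := (hwalk a b hab hb).walkDist_le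
    have h2 := (hwalk 0 a (by omega) (by omega)).walkDist_le
    have h3 := (hwalk b (r * k) (by omega) le_rfl).walkDist_le
    have h4 := walkDist_triangle (hwalk 0 a (by omega) (by omega)).digReach
      (hwalk a b hab hb).digReach
    have h5 := walkDist_triangle (hwalk 0 b (by omega) (by omega)).digReach
      (hwalk b (r * k) (by omega) le_rfl).digReach
    rw [h0, hfr, hr] at h5
    rw [hfr] at h3
    rw [h0] at h4 h2
    omega
  have hmul : ∀ i : Fin r, i.1 * k + k ≤ r * k := fun i => by
    rw [← Nat.succ_mul]; exact Nat.mul_le_mul_right k i.2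
  have hwin : ∀ i : Fin r, ∃ z ∈ S, digReach E (f (i.1 * k)) z ∧
      digReach E z (f (i.1 * k + k)) ∧ 1 ≤ walkDist (E ∪ F) (f (i.1 * k)) z ∧
      walkDist (E ∪ F) (f (i.1 * k)) z + walkDist (E ∪ F) z (f (i.1 * k + k)) = k := by
    intro i
    have hw := hwalk (i.1 * k) (i.1 * k + k) (by omega) (hmul i)
    have hd := hdist (i.1 * k) (i.1 * k + k) (by omega) (hmul i)
    rw [Nat.add_sub_cancel_left] at hw hd
    exact exists_mem_between_of_union hF hFS hS hw hd
  choose z hzS hz1 hz2 hz3 hz4 using hwin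
  have hu : ∀ i, digReach E u (z i) := fun i => by
    have := hreach 0 (i.1 * k) (by omega) (by have := hmul i; omega)
    rw [h0] at this
    exact this.trans (hz1 i)
  have hv : ∀ i, digReach E (z i) v := fun i => by
    have := hreach (i.1 * k + k) (r * k) (hmul i) le_rfl
    rw [hfr] at this
    exact (hz2 i).trans this
  have hval : ∀ i, walkDist (E ∪ F) u (z i) = i.1 * k + walkDist (E ∪ F) (f (i.1 * k)) (z i) ∧
      walkDist (E ∪ F) (z i) v ≤ r * k := by
    intro i
    have hi := hmul i
    have h1 := walkDist_triangle (hreach 0 (i.1 * k) (by omega) (by omega)).union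
      ((hz1 i).union (H := F))
    have h2 := walkDist_triangle ((hz2 i).union (H := F))
      (hreach (i.1 * k + k) (r * k) hi le_rfl).union
    have h3 := walkDist_triangle ((hu i).union (H := F)) (hv i).union
    rw [hdist _ _ (by omega) (by omega), h0] at h1
    rw [hdist _ _ hi le_rfl, hfr] at h2
    have := hz4 i
    omega
  have hstep : ∀ i j : Fin r, i < j → i.1 * k + k ≤ j.1 * k := fun i j hij => by
    rw [← Nat.succ_mul]; exact Nat.mul_le_mul_right k hij
  refine ⟨z, hzS, fun i j hij => ?_, hu, hv, fun i => (hval i).2, fun i j hij => ?_⟩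
  · rcases hij.eq_or_lt with rfl | hij
    · exact digReach_refl E _
    · exact ((hz2 i).trans (hreach _ _ (hstep i j hij) (by have := hmul j; omega))).trans (hz1 j)
  · have h1 := hstep i j hij
    have h2 := hz4 i
    have h3 := hz3 j
    have h4 := (hval i).1
    have h5 := (hval j).1
    simp only
    omega

end Landmarks

section Chains

variable {V : Type*} {E : Set (V × V)}

/-- A maximal family of disjoint chains of length `l` in `S`: every sequence of `2 * l` distinct,
successively reachable elements of `S` meets these chains more than `l` times. -/
theorem exists_maximal_chains [Fintype V] (E : Set (V × V)) (S : Finset V) {l : ℕ} (hl : 1 ≤ l) :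
    ∃ (M : ℕ) (c : Fin M → Fin l → V), Function.Injective (fun p : Fin M × Fin l => c p.1 p.2) ∧
      (∀ a i, c a i ∈ S) ∧ (∀ a i j, i ≤ j → digReach E (c a i) (c a j)) ∧
      ∀ z : Fin l → V, Function.Injective z → (∀ i, z i ∈ S) →
        (∀ i j, i ≤ j → digReach E (z i) (z j)) → ∃ i a j, z i = c a j := by
  classical
  let P : ℕ → Prop := fun M => ∃ c : Fin M → Fin l → V,
    Function.Injective (fun p : Fin M × Fin l => c p.1 p.2) ∧
      (∀ a i, c a i ∈ S) ∧ (∀ a i j, i ≤ j → digReach E (c a i) (c a j))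
  have hP0 : P 0 := ⟨fun a => a.elim0, fun p => p.1.elim0, fun a => a.elim0, fun a => a.elim0⟩
  have hbound : ∀ M, P M → M ≤ Fintype.card V := by
    rintro M ⟨c, hc, -⟩
    have := Fintype.card_le_of_injective _ hc
    simp only [Fintype.card_prod, Fintype.card_fin] at this
    nlinarith
  set M := Nat.findGreatest P (Fintype.card V) with hM
  have hPM : P M := Nat.findGreatest_spec (Nat.zero_le _) hP0
  obtain ⟨c, hc, hcS, hcm⟩ := hPM
  refine ⟨M, c, hc, hcS, hcm, fun z hz hzS hzm => ?_⟩
  by_contra! hcon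
  have hsucc : P (M + 1) := by
    refine ⟨Fin.cons z c, ?_, ?_, ?_⟩
    · rintro ⟨a, i⟩ ⟨b, j⟩ h
      induction a using Fin.cases with
      | zero =>
        induction b using Fin.cases with
        | zero => simpa using hz (by simpa using h)
        | succ b => exact absurd (by simpa using h) (hcon i b j)
      | succ a =>
        induction b using Fin.cases with
        | zero => exact absurd (by simpa using h.symm) (hcon j a i)
        | succ b =>
          have := @hc (a, i) (b, j) (by simpa using h)
          simpa using this
    · intro a i
      induction a using Fin.cases with
      | zero => simpa using hzS i
      | succ a => simpa using hcS a i
    · intro a i j hij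
      induction a using Fin.cases with
      | zero => simpa using hzm i j hij
      | succ a => simpa using hcm a i j hij
  have := Nat.le_findGreatest (hbound _ hsucc) hsucc
  omega

/-- The endpoint of the dyadic interval of length `2 ^ b` containing `i` (the lower one for
`t = false`, the upper one for `t = true`). -/
def dyadicHub (i b : ℕ) (t : Bool) : ℕ := (i / 2 ^ b + t.toNat) * 2 ^ b

theorem exists_common_dyadicHub {i j B : ℕ} (hij : i < j) (hj : j < 2 ^ B) :
    ∃ b < B, dyadicHub i b true = dyadicHub j b false ∧ i ≤ dyadicHub i b true ∧
      dyadicHub i b true ≤ j := by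
  have hex : ∃ b, i / 2 ^ b = j / 2 ^ b :=
    ⟨B, by rw [Nat.div_eq_of_lt hj, Nat.div_eq_of_lt (hij.trans hj)]⟩
  classical
  set b := Nat.find hex with hb
  have hbB : b ≤ B := Nat.find_min' hex
    (by rw [Nat.div_eq_of_lt hj, Nat.div_eq_of_lt (hij.trans hj)])
  have hspec : i / 2 ^ b = j / 2 ^ b := Nat.find_spec hex
  have hb0 : b ≠ 0 := by
    intro h0
    rw [h0] at hspec
    simp at hspec
    omega
  obtain ⟨e, he⟩ := Nat.exists_eq_succ_of_ne_zero hb0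
  have hne : i / 2 ^ e ≠ j / 2 ^ e := Nat.find_min hex (by omega)
  have hle : i / 2 ^ e ≤ j / 2 ^ e := Nat.div_le_div_right hij.le
  rw [he, Nat.succ_eq_add_one, pow_succ, ← Nat.div_div_eq_div_mul, ← Nat.div_div_eq_div_mul]
    at hspec
  have heq : j / 2 ^ e = i / 2 ^ e + 1 := by omega
  refine ⟨e, by omega, ?_, ?_, ?_⟩
  · simp [dyadicHub, heq]
  · have := Nat.lt_div_mul_add (a := i) (b := 2 ^ e) (by positivity)
    simp only [dyadicHub, Bool.toNat_true, add_mul, one_mul]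
    omega
  · simp only [dyadicHub, Bool.toNat_true, ← heq]
    exact Nat.div_mul_le_self _ _

/-- `O(M l B)` shortcut edges that connect any two reachable vertices of the same chain by a walk
of length at most two. -/
theorem exists_chain_shortcut {M l B : ℕ} (hl : l ≤ 2 ^ B) (c : Fin M → Fin l → V)
    (hc : ∀ a i j, i ≤ j → digReach E (c a i) (c a j)) :
    ∃ F ⊆ digTC E, (∀ p ∈ F, ∃ a i, p.2 = c a i) ∧ F.ncard ≤ 4 * (M * l) * B ∧
      ∀ a i j, digReach E (c a i) (c a j) → ∃ m ≤ 2, hasWalk (E ∪ F) (c a i) (c a j) m := by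
  classical
  let hub : Fin l → Fin B → Bool → Fin l := fun i b t =>
    if h : dyadicHub i b t < l then ⟨_, h⟩ else i
  let g : (Fin M × Fin l) × Fin B × Bool × Bool → V × V := fun q =>
    if q.2.2.2 then (c q.1.1 q.1.2, c q.1.1 (hub q.1.2 q.2.1 q.2.2.1))
    else (c q.1.1 (hub q.1.2 q.2.1 q.2.2.1), c q.1.1 q.1.2)
  have hmid : ∀ i j : Fin l, i < j → ∃ b t t', ∃ m : Fin l, i ≤ m ∧ m ≤ j ∧
      hub i b t = m ∧ hub j b t' = m := by
    intro i j hij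
    obtain ⟨b, hb, h1, h2, h3⟩ := exists_common_dyadicHub hij (j.2.trans_le hl)
    have hlt : dyadicHub i b true < l := h3.trans_lt j.2
    refine ⟨⟨b, hb⟩, true, false, ⟨dyadicHub i b true, hlt⟩, h2, h3, ?_, ?_⟩
    · simp [hub, hlt]
    · simp [hub, ← h1, hlt]
  refine ⟨digTC E ∩ Set.range g, Set.inter_subset_left, ?_, ?_, ?_⟩
  · rintro p ⟨-, q, rfl⟩
    by_cases hq : q.2.2.2 = true
    · exact ⟨q.1.1, hub q.1.2 q.2.1 q.2.2.1, by simp [g, hq]⟩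
    · exact ⟨q.1.1, q.1.2, by simp [g, hq]⟩
  · calc (digTC E ∩ Set.range g).ncard ≤ (Set.range g).ncard :=
          Set.ncard_le_ncard Set.inter_subset_right (Set.toFinite _)
      _ ≤ Fintype.card ((Fin M × Fin l) × Fin B × Bool × Bool) := by
          rw [← Set.image_univ, ← Nat.card_eq_fintype_card, ← Set.ncard_univ]
          exact Set.ncard_image_le (Set.toFinite _)
      _ = 4 * (M * l) * B := by simp; ring
  · have hone : ∀ x y, digReach E x y → (x, y) ∈ Set.range g →
        ∃ m ≤ 1, hasWalk (E ∪ (digTC E ∩ Set.range g)) x y m := by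
      intro x y hxy hg
      rcases hxy.eq_or_mem_digTC with h | h
      · exact ⟨0, by omega, hasWalk_zero_s14.2 h⟩
      · exact ⟨1, le_rfl, hasWalk_one_s14.2 (Or.inr ⟨h, hg⟩)⟩
    have htwo : ∀ a (i j m : Fin l) b t t', hub i b t = m → hub j b t' = m →
        digReach E (c a i) (c a m) → digReach E (c a m) (c a j) →
        ∃ n ≤ 2, hasWalk (E ∪ (digTC E ∩ Set.range g)) (c a i) (c a j) n := by
      intro a i j m b t t' hi hj him hmj
      obtain ⟨m1, hm1, hw1⟩ := hone _ _ him ⟨((a, i), b, t, true), by simp [g, hi]⟩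
      obtain ⟨m2, hm2, hw2⟩ := hone _ _ hmj ⟨((a, j), b, t', false), by simp [g, hj]⟩
      exact ⟨m1 + m2, by omega, hasWalk_add.2 ⟨_, hw1, hw2⟩⟩
    intro a i j hij
    rcases lt_trichotomy i j with h | rfl | h
    · obtain ⟨b, t, t', m, h1, h2, h3, h4⟩ := hmid i j h
      exact htwo a i j m b t t' h3 h4 (hc a i m h1) (hc a m j h2)
    · exact ⟨0, by omega, hasWalk_zero_s14.2 rfl⟩
    · obtain ⟨b, t, t', m, h1, h2, h3, h4⟩ := hmid j i h
      exact htwo a i j m b t' t h4 h3 (hij.trans (hc a j m h1)) ((hc a m i h2).trans hij)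

end Chains

section Shortcut

variable {V : Type*} {E : Set (V × V)}

/-- A set of at most `4 B |V| / k` vertices hitting a geodesic between any two vertices at
distance `k`. -/
theorem exists_geodesic_hitting [Fintype V] (E : Set (V × V)) {B k : ℕ}
    (hB : Fintype.card V ≤ 2 ^ B) (hB1 : 1 ≤ B) (hk : 1 ≤ k) :
    ∃ S : Finset V, S.card * k ≤ 4 * B * Fintype.card V ∧
      ∀ x y, digReach E x y → walkDist E x y = k → ∃ z ∈ S, digReach E x z ∧ digReach E z y ∧
        1 ≤ walkDist E x z ∧ walkDist E x z + walkDist E z y = k := by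
  classical
  let I : Finset (V × V) := Finset.univ.filter fun p => digReach E p.1 p.2 ∧ walkDist E p.1 p.2 = k
  have hI : ∀ p : V × V, ∃ A : Finset V, p ∈ I → (k ≤ A.card ∧ ∀ z ∈ A, digReach E p.1 z ∧
      digReach E z p.2 ∧ 1 ≤ walkDist E p.1 z ∧ walkDist E p.1 z + walkDist E z p.2 = k) := by
    intro p
    by_cases hp : p ∈ I
    · have hp' := (Finset.mem_filter.1 hp).2
      obtain ⟨A, hA⟩ := hp'.1.le_card_between
      rw [hp'.2] at hA
      exact ⟨A, fun _ => hA⟩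
    · exact ⟨∅, fun h => absurd h hp⟩
  choose A hA using hI
  obtain ⟨S, hS, hcard⟩ := exists_hitting I A hk (b := 2 * B) (by omega)
    (by
      calc I.card ≤ Fintype.card (V × V) := Finset.card_le_univ _
        _ ≤ 2 ^ B * 2 ^ B := by rw [Fintype.card_prod]; exact Nat.mul_le_mul hB hB
        _ = 2 ^ (2 * B) := by ring)
    (fun p hp => (hA p hp).1)
  refine ⟨S, by rw [← mul_assoc] at hcard; exact hcard, fun x y hxy hd => ?_⟩
  have hp : (x, y) ∈ I := by simp [I, hxy, hd]
  obtain ⟨z, hz, hzS⟩ := hS _ hp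
  exact ⟨z, hzS, (hA _ hp).2 z hz⟩

/-- A monotone sequence of `2 * l` landmarks, at most `l` of which avoid the chains and any two of
which on a common chain are at distance at most two, meets at least `l / 3 + 1` chains. -/
theorem le_card_chains_met {M l : ℕ} {S : Finset V} {c : Fin M → Fin l → V}
    (hmax : ∀ z : Fin l → V, Function.Injective z → (∀ i, z i ∈ S) →
        (∀ i j, i ≤ j → digReach E (z i) (z j)) → ∃ i a j, z i = c a j)
    (z : Fin (2 * l) → V) (hzS : ∀ i, z i ∈ S)
    (hz : ∀ i j, i ≤ j → digReach E (z i) (z j)) (φ : V → ℕ)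
    (hφ : StrictMono fun i => φ (z i))
    (hclose : ∀ i j a b b', i ≤ j → z i = c a b → z j = c a b' → φ (z j) ≤ φ (z i) + 2) :
    ∃ Q : Finset (Fin M), l / 3 + 1 ≤ Q.card ∧ ∀ a ∈ Q, ∃ i b, z i = c a b := by
  classical
  have hzinj : Function.Injective z := fun i j hij => hφ.injective (by simp [hij])
  let T : Finset (Fin (2 * l)) := Finset.univ.filter fun i => ∃ a b, z i = c a b
  have hTc : Tᶜ.card < l := by
    by_contra! hcon
    obtain ⟨T', hT', hcard⟩ := Finset.exists_subset_card_eq hcon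
    let e := T'.orderEmbOfFin hcard
    obtain ⟨i, a, j, h⟩ := hmax (fun i => z (e i)) (hzinj.comp e.injective) (fun i => hzS _)
      (fun i j hij => hz _ _ (e.monotone hij))
    have h1 := hT' (T'.orderEmbOfFin_mem hcard i)
    rw [Finset.mem_compl] at h1
    exact h1 (Finset.mem_filter.2 ⟨Finset.mem_univ _, a, j, h⟩)
  have hT : l < T.card := by
    have := Finset.card_add_card_compl T
    rw [Fintype.card_fin] at this
    omega
  have hex : ∀ i : Fin (2 * l), ∃ a : Option (Fin M), i ∈ T → ∃ a', a = some a' ∧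
      ∃ b, z i = c a' b := by
    intro i
    by_cases hi : i ∈ T
    · obtain ⟨a, b, h⟩ := (Finset.mem_filter.1 hi).2
      exact ⟨some a, fun _ => ⟨a, rfl, b, h⟩⟩
    · exact ⟨none, fun h => absurd h hi⟩
  choose ch hch using hex
  have hfib : T.card ≤ 3 * (T.image ch).card := by
    refine Finset.card_le_mul_card_image T 3 fun a ha => ?_
    obtain ⟨i₀, hi₀, rfl⟩ := Finset.mem_image.1 ha
    set R : Finset (Fin (2 * l)) := {i ∈ T | ch i = ch i₀} with hR
    have hRne : R.Nonempty := ⟨i₀, by simp [hR, hi₀]⟩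
    have hmin := R.min'_mem hRne
    set i₁ := R.min' hRne with hi₁
    calc R.card = (R.image fun i => φ (z i)).card :=
          (Finset.card_image_of_injective _ hφ.injective).symm
      _ ≤ (Finset.Icc (φ (z i₁)) (φ (z i₁) + 2)).card := Finset.card_le_card ?_
      _ = 3 := by simp; omega
    intro x hx
    obtain ⟨i, hi, rfl⟩ := Finset.mem_image.1 hx
    have hle : i₁ ≤ i := R.min'_le i hi
    rw [hR, Finset.mem_filter] at hi hmin
    obtain ⟨a, ha, b, hb⟩ := hch i hi.1
    obtain ⟨a', ha', b', hb'⟩ := hch i₁ hmin.1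
    have haa : a = a' := by
      rw [hi.2, ← hmin.2, ha'] at ha
      exact (Option.some.inj ha).symm
    subst haa
    rw [Finset.mem_Icc]
    exact ⟨hφ.monotone hle, hclose i₁ i a b' b hle hb' hb⟩
  refine ⟨Finset.univ.filter fun a => ∃ i b, z i = c a b, ?_, by simp⟩
  have hsub : T.image ch ⊆ (Finset.univ.filter fun a => ∃ i b, z i = c a b).image some := by
    intro o ho
    obtain ⟨i, hi, rfl⟩ := Finset.mem_image.1 ho
    obtain ⟨a, ha, b, hb⟩ := hch i hi
    rw [ha]
    exact Finset.mem_image_of_mem _ (Finset.mem_filter.2 ⟨Finset.mem_univ _, i, b, hb⟩)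
  have h1 := (Finset.card_le_card hsub).trans Finset.card_image_le
  omega

/-- A set of shortcut edges from vertices to chains such that every far pair `(u, v)` is connected
through one of them. -/
theorem exists_vertex_chain_shortcut [Fintype V] {M l B a q : ℕ}
    (hB : Fintype.card V ≤ 2 ^ B) (hB1 : 1 ≤ B) (c : Fin M → Fin l → V) (I : Finset (V × V))
    (A : V × V → Finset V) (Q : V × V → Finset (Fin M)) (ha : 1 ≤ a) (hq : 1 ≤ q)
    (hA : ∀ p ∈ I, a ≤ (A p).card) (hQ : ∀ p ∈ I, q ≤ (Q p).card) :
    ∃ F ⊆ digTC E, F.ncard * (a * q) ≤ 4 * B * (Fintype.card V * M) ∧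
      ∀ p ∈ I, ∃ x ∈ A p, ∃ b ∈ Q p, ∀ j, digReach E x (c b j) → ∃ i ≤ j,
        digReach E x (c b i) ∧ ∃ m ≤ 1, hasWalk F x (c b i) m := by
  classical
  obtain ⟨R, hR, hcard⟩ := exists_hitting I (fun p => A p ×ˢ Q p) (a := a * q) (b := 2 * B)
    (Nat.mul_pos ha hq) (by omega)
    (by
      calc I.card ≤ Fintype.card (V × V) := Finset.card_le_univ _
        _ ≤ 2 ^ B * 2 ^ B := by rw [Fintype.card_prod]; exact Nat.mul_le_mul hB hB
        _ = 2 ^ (2 * B) := by ring)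
    (fun p hp => by rw [Finset.card_product]; exact Nat.mul_le_mul (hA p hp) (hQ p hp))
  have hfirst : ∀ r : V × Fin M, ∃ y, ∀ j, digReach E r.1 (c r.2 j) → ∃ i ≤ j,
      y = c r.2 i ∧ digReach E r.1 y := by
    intro r
    by_cases h : ∃ j, digReach E r.1 (c r.2 j)
    · obtain ⟨i, hi, hmin⟩ := Set.exists_min_image {j | digReach E r.1 (c r.2 j)} id
        (Set.toFinite _) h
      exact ⟨c r.2 i, fun j hj => ⟨i, hmin j hj, rfl, hi⟩⟩
    · exact ⟨r.1, fun j hj => absurd ⟨j, hj⟩ h⟩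
  choose first hfirst using hfirst
  refine ⟨digTC E ∩ ((fun r => (r.1, first r)) '' (R : Set (V × Fin M))), Set.inter_subset_left,
    ?_, ?_⟩
  · have h1 : (digTC E ∩ ((fun r => (r.1, first r)) '' (R : Set (V × Fin M)))).ncard ≤ R.card := by
      calc _ ≤ ((fun r => (r.1, first r)) '' (R : Set (V × Fin M))).ncard :=
            Set.ncard_le_ncard Set.inter_subset_right (Set.toFinite _)
        _ ≤ (R : Set (V × Fin M)).ncard := Set.ncard_image_le (Set.toFinite _)
        _ = R.card := Set.ncard_coe_finset R
    rw [Fintype.card_prod, Fintype.card_fin, ← mul_assoc 2 2 B] at hcard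
    exact (Nat.mul_le_mul_right _ h1).trans hcard
  · intro p hp
    obtain ⟨⟨x, b⟩, hxb, hxR⟩ := hR p hp
    rw [Finset.mem_product] at hxb
    refine ⟨x, hxb.1, b, hxb.2, fun j hj => ?_⟩
    obtain ⟨i, hij, hy, hreach⟩ := hfirst (x, b) j hj
    rw [hy] at hreach
    refine ⟨i, hij, hreach, ?_⟩
    rcases hreach.eq_or_mem_digTC with h | h
    · exact ⟨0, by omega, hasWalk_zero_s14.2 h⟩
    · exact ⟨1, le_rfl, hasWalk_one_s14.2 ⟨h, (x, b), hxR, by simp [hy]⟩⟩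

/-- Shortcutting to diameter `4 * l * k + 3`. -/
theorem exists_shortcut_of_scales [Fintype V] (E : Set (V × V)) {B l k : ℕ}
    (hB : Fintype.card V ≤ 2 ^ B) (hB1 : 1 ≤ B) (hl : 1 ≤ l) (hk : 1 ≤ k) :
    ∃ F₁ F₂ : Set (V × V), F₁ ⊆ digTC E ∧ F₂ ⊆ digTC E ∧
      F₁.ncard * k ≤ 16 * B ^ 2 * Fintype.card V ∧
      F₂.ncard * (l ^ 3 * k ^ 2) ≤ 24 * B ^ 2 * Fintype.card V ^ 2 ∧
      ∀ u v, digReach E u v → ∃ m ≤ 4 * l * k + 3, hasWalk (E ∪ (F₁ ∪ F₂)) u v m := by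
  classical
  obtain ⟨S, hScard, hS⟩ := exists_geodesic_hitting E hB hB1 hk
  obtain ⟨M, c, hcinj, hcS, hcm, hmax⟩ := exists_maximal_chains E S hl
  have hMl : M * l ≤ S.card := by
    have := Finset.card_le_card_of_injOn (s := Finset.univ)
      (t := S) (fun p : Fin M × Fin l => c p.1 p.2) (fun p _ => hcS _ _) hcinj.injOn
    simpa using this
  obtain ⟨F₁, hF₁, hF₁c, hF₁card, hF₁w⟩ : ∃ F ⊆ digTC E, (∀ p ∈ F, ∃ a i, p.2 = c a i) ∧
      F.ncard ≤ 4 * (M * l) * B ∧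
      ∀ a i j, digReach E (c a i) (c a j) → ∃ m ≤ 2, hasWalk (E ∪ F) (c a i) (c a j) m := by
    rcases Nat.eq_zero_or_pos M with rfl | hM
    · exact ⟨∅, by simp, by simp, by simp, fun a => a.elim0⟩
    · refine exists_chain_shortcut (le_trans ?_ hB) c hcm
      have := Fintype.card_le_of_injective (c ⟨0, hM⟩) fun i j hij => by
        have := @hcinj (⟨0, hM⟩, i) (⟨0, hM⟩, j) hij
        simpa using this
      simpa using this
  have hF₁S : ∀ p ∈ F₁, p.2 ∈ (S : Set V) := fun p hp => by
    obtain ⟨a, i, h⟩ := hF₁c p hp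
    rw [h]
    exact hcS a i
  set H := E ∪ F₁ with hH
  have hHE : ∀ {x y}, digReach H x y → digReach E x y := fun h => h.of_union hF₁
  have hEH : ∀ {x y}, digReach E x y → digReach H x y := fun h => h.union
  let I : Finset (V × V) := Finset.univ.filter fun p =>
    digReach E p.1 p.2 ∧ 2 * (2 * l * k) ≤ walkDist H p.1 p.2
  have hfar : ∀ p : V × V, ∃ (A : Finset V) (Q : Finset (Fin M)), p ∈ I →
      2 * l * k ≤ A.card ∧ l / 3 + 1 ≤ Q.card ∧ ∀ x ∈ A, ∀ a ∈ Q, digReach E p.1 x ∧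
        walkDist H p.1 x ≤ 2 * l * k ∧ ∃ j, digReach E x (c a j) ∧ digReach E (c a j) p.2 ∧
          walkDist H (c a j) p.2 ≤ 2 * l * k := by
    rintro ⟨u, v⟩
    by_cases hp : (u, v) ∈ I
    swap
    · exact ⟨∅, ∅, fun h => absurd h hp⟩
    obtain ⟨huv, hd⟩ := (Finset.mem_filter.1 hp).2
    simp only at huv hd
    obtain ⟨w, huw, hwv, hdw, hdw'⟩ := (hEH huv).exists_between (t := 2 * l * k) (by omega)
    obtain ⟨w', hww, hwv', hd1, hd2⟩ := hwv.exists_between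
      (t := walkDist H w v - 2 * l * k) (by omega)
    obtain ⟨A, hA, hA'⟩ := huw.le_card_between
    obtain ⟨z, hzS, hz, hwz, hzv, hzd, hmono⟩ := exists_landmarks hF₁ hF₁S hS hwv'
      (r := 2 * l) (by rw [← hH]; omega)
    obtain ⟨Q, hQ, hQ'⟩ := le_card_chains_met hmax z hzS hz (walkDist H w') hmono (by
      intro i j a b b' hij hi hj
      have h1 := walkDist_triangle (hEH (hwz i)) (hEH (hz i j hij))
      have h2 : digReach E (c a b) (c a b') := by
        rw [← hi, ← hj]
        exact hz i j hij
      obtain ⟨m, hm, hw⟩ := hF₁w a b b' h2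
      rw [← hi, ← hj] at hw
      have h3 := hw.walkDist_le
      omega)
    refine ⟨A, Q, fun _ => ⟨by omega, hQ, fun x hx a ha => ?_⟩⟩
    obtain ⟨i, b, hib⟩ := hQ' a ha
    obtain ⟨hux, hxw, -, hdx⟩ := hA' x hx
    refine ⟨hHE hux, by simp only; omega, b, ?_, ?_, ?_⟩
    · rw [← hib]
      exact ((hHE hxw).trans (hHE hww)).trans (hwz i)
    · rw [← hib]
      exact hzv i
    · rw [← hib]
      exact hzd i
  choose A Q hAQ using hfar
  have hlk : 1 ≤ 2 * l * k := Nat.mul_pos (by omega) hk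
  obtain ⟨F₂, hF₂, hF₂card, hF₂w⟩ := exists_vertex_chain_shortcut (E := E) hB hB1 c I A Q
    hlk (Nat.succ_pos (l / 3)) (fun p hp => (hAQ p hp).1) (fun p hp => (hAQ p hp).2.1)
  refine ⟨F₁, F₂, hF₁, hF₂, ?_, ?_, ?_⟩
  · calc F₁.ncard * k ≤ 4 * (M * l) * B * k := Nat.mul_le_mul_right k hF₁card
      _ = 4 * B * (M * l * k) := by ring
      _ ≤ 4 * B * (4 * B * Fintype.card V) := Nat.mul_le_mul_left _
          ((Nat.mul_le_mul_right k hMl).trans hScard)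
      _ = _ := by ring
  · have hq : l ≤ 3 * (l / 3 + 1) := by omega
    have h1 : 2 * (F₂.ncard * (l ^ 3 * k ^ 2)) ≤ 2 * (24 * B ^ 2 * Fintype.card V ^ 2) := by
      calc 2 * (F₂.ncard * (l ^ 3 * k ^ 2)) = F₂.ncard * (2 * l * k * l) * l * k := by ring
        _ ≤ F₂.ncard * (2 * l * k * (3 * (l / 3 + 1))) * l * k := by gcongr
        _ = 3 * (F₂.ncard * (2 * l * k * (l / 3 + 1))) * l * k := by ring
        _ ≤ 3 * (4 * B * (Fintype.card V * M)) * l * k := by gcongr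
        _ = 12 * B * Fintype.card V * (M * l * k) := by ring
        _ ≤ 12 * B * Fintype.card V * (4 * B * Fintype.card V) := Nat.mul_le_mul_left _
            ((Nat.mul_le_mul_right k hMl).trans hScard)
        _ = _ := by ring
    omega
  · intro u v huv
    have hsub : H ⊆ E ∪ (F₁ ∪ F₂) := by
      rw [hH, ← Set.union_assoc]
      exact Set.subset_union_left
    have hsub₂ : F₂ ⊆ E ∪ (F₁ ∪ F₂) := fun p hp => Or.inr (Or.inr hp)
    by_cases hp : (u, v) ∈ I
    · obtain ⟨x, hx, a, ha, hj⟩ := hF₂w _ hp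
      obtain ⟨hux, hdx, j, hxj, hjv, hdj⟩ := (hAQ _ hp).2.2 x hx a ha
      obtain ⟨i, hij, -, m, hm, hw⟩ := hj j hxj
      obtain ⟨m', hm', hw'⟩ := hF₁w a i j (hcm a i j hij)
      refine ⟨walkDist H u x + m + m' + walkDist H (c a j) v, ?_, ?_⟩
      · have h4 : 4 * l * k = 2 * l * k + 2 * l * k := by ring
        simp only at hdx hdj
        omega
      · have h1 := (hEH hux).hasWalk_walkDist.mono hsub
        have h2 := (hEH hjv).hasWalk_walkDist.mono hsub
        exact hasWalk_add.2 ⟨_, hasWalk_add.2 ⟨_, hasWalk_add.2 ⟨_, h1, hw.mono hsub₂⟩,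
          hw'.mono hsub⟩, h2⟩
    · have hlt : walkDist H u v < 2 * (2 * l * k) := by
        by_contra! hcon
        exact hp (by simp [I, huv, hcon])
      refine ⟨walkDist H u v, ?_, (hEH huv).hasWalk_walkDist.mono hsub⟩
      have h4 : 4 * l * k = 2 * (2 * l * k) := by ring
      omega

end Shortcut

section Bounds

/-- Scales `l`, `k` with `4 * l * k + 3 ≤ D` that balance the two parts of the shortcut. -/
theorem exists_scales {n D : ℕ} (hD : 12 ≤ D) (hDn : D ≤ n) :
    ∃ l k : ℕ, 1 ≤ l ∧ 1 ≤ k ∧ 4 * l * k + 3 ≤ D ∧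
      (1 : ℝ) / k ≤ 16 * √(n / D ^ 3) ∧
      (n : ℝ) / (l ^ 3 * k ^ 2) ≤ 1331 * (n / D ^ 3 + √(n / D ^ 3)) := by
  have hD0 : (12 : ℝ) ≤ D := by exact_mod_cast hD
  have hDn' : (D : ℝ) ≤ n := by exact_mod_cast hDn
  have hn0 : (0 : ℝ) < n := by linarith
  set r := √((n : ℝ) / D ^ 3) with hr
  have hr2 : r ^ 2 = n / D ^ 3 := Real.sq_sqrt (by positivity)
  have hr0 : 0 < r := Real.sqrt_pos.2 (by positivity)
  have hrD : 1 / r ≤ D := by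
    rw [div_le_iff₀ hr0, ← div_le_iff₀' (by linarith), hr]
    apply Real.le_sqrt_of_sq_le
    rw [div_pow, one_pow, div_le_div_iff₀ (by positivity) (by positivity)]
    nlinarith [pow_pos (by linarith : (0 : ℝ) < D) 2]
  set x := 1 / (8 * r) with hx
  have hx0 : 0 < x := by positivity
  have hxr : x * r = 1 / 8 := by rw [hx]; field_simp
  have hxD : x ≤ D / 8 := by
    have : x = 1 / r / 8 := by rw [hx]; field_simp
    linarith
  set k := max 1 ⌊x⌋₊ with hk
  have hk1 : 1 ≤ k := le_max_left _ _
  have hk1' : (1 : ℝ) ≤ k := by exact_mod_cast hk1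
  have hkx : x / 2 ≤ k := by
    have h1 := Nat.lt_floor_add_one x
    have h2 : (⌊x⌋₊ : ℝ) ≤ k := by exact_mod_cast le_max_right _ _
    linarith
  have hkx' : (k : ℝ) ≤ 1 + x := by
    rw [hk]
    push_cast
    exact max_le (by linarith) ((Nat.floor_le hx0.le).trans (by linarith))
  have hkD : (k : ℝ) ≤ D / 8 + 1 / 3 := by
    rw [hk]
    push_cast
    exact max_le (by linarith) ((Nat.floor_le hx0.le).trans (by linarith))
  have hkD' : 24 * k ≤ 3 * D + 8 := by
    have : (24 * k : ℝ) ≤ 3 * D + 8 := by linarith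
    exact_mod_cast this
  set l := (D - 3) / (4 * k) with hl
  have hl1 : 1 ≤ l := (Nat.one_le_div_iff (by omega)).2 (by omega)
  have hlk : l * (4 * k) ≤ D - 3 := Nat.div_mul_le_self _ _
  have hlk2 : D - 3 < l * (4 * k) + 4 * k := Nat.lt_div_mul_add (by omega)
  have hlk3 : D ≤ 11 * (l * k) := by
    have h1 : k ≤ l * k := Nat.le_mul_of_pos_left k hl1
    have h2 : l * (4 * k) = 4 * (l * k) := by ring
    omega
  have hlk' : 4 * l * k = l * (4 * k) := by ring
  refine ⟨l, k, hl1, hk1, by omega, ?_, ?_⟩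
  · rw [div_le_iff₀ (by linarith)]
    nlinarith
  · have hlk4 : (D : ℝ) ≤ 11 * (l * k) := by exact_mod_cast hlk3
    have hl1' : (1 : ℝ) ≤ l := by exact_mod_cast hl1
    have hcube : (D : ℝ) ^ 3 ≤ 1331 * (l ^ 3 * k ^ 3) := by
      calc (D : ℝ) ^ 3 ≤ (11 * (l * k)) ^ 3 := by gcongr
        _ = _ := by ring
    have hk0 : (k : ℝ) ≠ 0 := by positivity
    have hl0 : (l : ℝ) ≠ 0 := by positivity
    calc (n : ℝ) / (l ^ 3 * k ^ 2) = (n * k : ℝ) / (l ^ 3 * k ^ 3) := by field_simp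
      _ ≤ 1331 * ((n * k : ℝ) / D ^ 3) := by
          rw [mul_div_assoc', div_le_div_iff₀ (by positivity) (by positivity)]
          calc (n : ℝ) * k * D ^ 3 ≤ n * k * (1331 * (l ^ 3 * k ^ 3)) := by gcongr
            _ = _ := by ring
      _ = 1331 * (r ^ 2 * k) := by rw [hr2]; ring
      _ ≤ 1331 * (r ^ 2 * (1 + x)) := by gcongr
      _ = 1331 * (r ^ 2 + r * (x * r)) := by ring
      _ ≤ 1331 * (n / D ^ 3 + r) := by rw [hxr, hr2]; linarith

theorem exists_shortcut {V : Type*} [Fintype V] (E : Set (V × V)) {n D : ℕ}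
    (hn : Fintype.card V = n) (hn2 : 2 ≤ n) (hD : 1 ≤ D) :
    ∃ F ⊆ digTC E,
      (F.ncard : ℝ) ≤ 200000 * Real.logb 2 n ^ 2 * n * (n / D ^ 3 + √(n / D ^ 3)) ∧
      ∀ u v, digReach E u v → ∃ m ≤ D, hasWalk (E ∪ F) u v m := by
  have hn2' : (2 : ℝ) ≤ n := by exact_mod_cast hn2
  have hD' : (1 : ℝ) ≤ D := by exact_mod_cast hD
  have hlog : 1 ≤ Real.logb 2 n := by
    rw [Real.le_logb_iff_rpow_le (by norm_num) (by linarith)]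
    simpa using hn2'
  have hr0 := Real.sqrt_nonneg ((n : ℝ) / D ^ 3)
  rcases le_total n D with hnD | hnD
  · refine ⟨∅, by simp, ?_, fun u v huv => ⟨walkDist E u v, ?_, ?_⟩⟩
    · simp only [Set.ncard_empty, Nat.cast_zero]
      positivity
    · have := huv.walkDist_lt_card
      omega
    · simpa using huv.hasWalk_walkDist
  rcases lt_or_ge D 12 with hD12 | hD12
  · refine ⟨digTC E, subset_rfl, ?_, fun u v huv => ?_⟩
    · have h1 : (digTC E).ncard ≤ n * n := by
        calc (digTC E).ncard ≤ (Set.univ : Set (V × V)).ncard :=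
              Set.ncard_le_ncard (Set.subset_univ _) (Set.toFinite _)
          _ = n * n := by rw [Set.ncard_univ, Nat.card_eq_fintype_card, Fintype.card_prod, hn]
      have h2 : ((digTC E).ncard : ℝ) ≤ n * n := by exact_mod_cast h1
      have h3 : (D : ℝ) ^ 3 ≤ 12 ^ 3 := by
        have : (D : ℝ) ≤ 12 := by exact_mod_cast hD12.le
        gcongr
      have h4 : (n : ℝ) ≤ 1728 * (n / D ^ 3) := by
        rw [mul_div_assoc', le_div_iff₀ (by positivity)]
        nlinarith
      calc ((digTC E).ncard : ℝ) ≤ n * n := h2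
        _ ≤ 1 * n * (1728 * (n / D ^ 3)) := by rw [one_mul]; gcongr
        _ ≤ Real.logb 2 n ^ 2 * n * (200000 * (n / D ^ 3 + √(n / D ^ 3))) := by
            gcongr
            · exact one_le_pow₀ hlog
            · norm_num
            · linarith
        _ = _ := by ring
    · rcases huv.eq_or_mem_digTC with h | h
      · exact ⟨0, by omega, hasWalk_zero_s14.2 h⟩
      · exact ⟨1, hD, hasWalk_one_s14.2 (Or.inr h)⟩
  · obtain ⟨l, k, hl, hk, hlk, h1, h2⟩ := exists_scales hD12 hnD
    set B := Nat.log 2 n + 1 with hB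
    have hBn : Fintype.card V ≤ 2 ^ B := hn ▸ (Nat.lt_pow_succ_log_self (by norm_num) n).le
    have hBlog : (B : ℝ) ≤ 2 * Real.logb 2 n := by
      have := Real.natLog_le_logb n 2
      rw [hB]
      push_cast at this ⊢
      linarith
    obtain ⟨F₁, F₂, hF₁, hF₂, hc₁, hc₂, hw⟩ :=
      exists_shortcut_of_scales E hBn (Nat.le_add_left 1 _) hl hk
    refine ⟨F₁ ∪ F₂, Set.union_subset hF₁ hF₂, ?_, fun u v huv => ?_⟩
    · rw [hn] at hc₁ hc₂
      have hk' : (0 : ℝ) < k := by exact_mod_cast hk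
      have hl' : (0 : ℝ) < l := by exact_mod_cast hl
      have hc₁' : (F₁.ncard : ℝ) ≤ 16 * B ^ 2 * n * (1 / k) := by
        rw [mul_one_div, le_div_iff₀ hk']
        exact_mod_cast hc₁
      have hc₂' : (F₂.ncard : ℝ) ≤ 24 * B ^ 2 * n * (n / (l ^ 3 * k ^ 2)) := by
        rw [mul_div_assoc', le_div_iff₀ (by positivity), mul_assoc _ (n : ℝ), ← sq]
        exact_mod_cast hc₂
      have hunion : ((F₁ ∪ F₂).ncard : ℝ) ≤ F₁.ncard + F₂.ncard := by
        exact_mod_cast Set.ncard_union_le F₁ F₂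
      calc ((F₁ ∪ F₂).ncard : ℝ)
          ≤ 16 * B ^ 2 * n * (1 / k) + 24 * B ^ 2 * n * (n / (l ^ 3 * k ^ 2)) := by linarith
        _ ≤ 16 * B ^ 2 * n * (16 * √(n / D ^ 3)) +
            24 * B ^ 2 * n * (1331 * (n / D ^ 3 + √(n / D ^ 3))) := by gcongr
        _ = B ^ 2 * (n * (31944 * (n / D ^ 3) + 32200 * √(n / D ^ 3))) := by ring
        _ ≤ (2 * Real.logb 2 n) ^ 2 *
            (n * (50000 * (n / D ^ 3) + 50000 * √(n / D ^ 3))) := by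
            gcongr <;> norm_num
        _ = _ := by ring
    · obtain ⟨m, hm, h⟩ := hw u v huv
      exact ⟨m, hm.trans hlk, h⟩

end Bounds

/-- There is a universal constant `C` such that for every `n`-vertex digraph
`G` (`n ≥ 2`), integers `s ≥ n`, `d ≥ 1`, `α_D ≥ 1` and real
`α_S ≥ C·n·(log n)²/√(s·d²·α_D³)`: if `G` admits an `(s,d)`-shortcut then there is
`E' ⊆ E^T∖E` with `|E'| ≤ α_S·s` such that `(V, E∪E')` has diameter at most `α_D·d`. -/
theorem stmt_14 :
    ∃ C : ℝ, 0 < C ∧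
      ∀ (V : Type) (_ : Fintype V) (E : Set (V × V)),
        (∀ v : V, (v, v) ∉ E) →
        ∀ n : ℕ, Fintype.card V = n → 2 ≤ n →
        ∀ s d αD : ℕ, n ≤ s → 1 ≤ d → 1 ≤ αD →
        ∀ αS : ℝ,
          C * (n : ℝ) * (Real.logb 2 n) ^ 2 /
            Real.sqrt ((s : ℝ) * (d : ℝ) ^ 2 * (αD : ℝ) ^ 3) ≤ αS →
        (∃ E₀, IsShortcut E E₀ s d) →
        ∃ E' ⊆ digTC E \ E, (E'.ncard : ℝ) ≤ αS * (s : ℝ) ∧ diamLE (E ∪ E') (αD * d) := by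
  refine ⟨400000, by norm_num, ?_⟩
  intro V _ E _ n hn hn2 s d αD hs hd hαD αS hαS ⟨E₀, hE₀, hE₀card, hE₀diam⟩
  have hn2' : (2 : ℝ) ≤ n := by exact_mod_cast hn2
  have hs' : (n : ℝ) ≤ s := by exact_mod_cast hs
  have hd' : (1 : ℝ) ≤ d := by exact_mod_cast hd
  have hαD' : (1 : ℝ) ≤ αD := by exact_mod_cast hαD
  rcases le_or_gt 1 αS with h1 | h1
  · refine ⟨E₀, hE₀, ?_, fun u v huv => (hE₀diam u v huv).trans ?_⟩
    · have : (E₀.ncard : ℝ) ≤ s := by exact_mod_cast hE₀card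
      nlinarith
    · exact_mod_cast Nat.le_mul_of_pos_left d hαD
  have hlog : 1 ≤ Real.logb 2 n := by
    rw [Real.le_logb_iff_rpow_le (by norm_num) (by linarith)]
    simpa using hn2'
  have hlog2 : 1 ≤ Real.logb 2 n ^ 2 := one_le_pow₀ hlog
  obtain ⟨F, hF, hFcard, hFw⟩ := exists_shortcut E hn hn2 (Nat.mul_pos hαD hd)
  refine ⟨F \ E, Set.sdiff_subset_sdiff_left hF, ?_, ?_⟩
  swap
  · rw [Set.union_sdiff_self]
    exact diamLE_of_hasWalk fun u v huv => hFw u v (huv.of_union hF)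
  have hFE : ((F \ E).ncard : ℝ) ≤ F.ncard := by
    exact_mod_cast Set.ncard_le_ncard Set.sdiff_subset (Set.toFinite _)
  refine (hFE.trans hFcard).trans ?_
  push_cast
  have hs0 : (0 : ℝ) < s := by linarith
  set P := √((s : ℝ) * d ^ 2 * αD ^ 3) with hP
  have hP0 : 0 < P := Real.sqrt_pos.2 (by positivity)
  have hP2 : P ^ 2 = s * d ^ 2 * αD ^ 3 := Real.sq_sqrt (by positivity)
  have hlow : √((n : ℝ) / (αD * d) ^ 3) ≤ s / P := by
    apply Real.sqrt_le_left (by positivity) |>.2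
    rw [div_pow, hP2, div_le_div_iff₀ (by positivity) (by positivity)]
    have hnsd : (n : ℝ) ≤ s * d := by nlinarith
    calc (n : ℝ) * (s * d ^ 2 * αD ^ 3) ≤ s * d * (s * d ^ 2 * αD ^ 3) := by gcongr
      _ = _ := by ring
  have hnP : (n : ℝ) ≤ P := by
    rw [div_le_iff₀ hP0] at hαS
    nlinarith
  have hlow' : (n : ℝ) / (αD * d) ^ 3 ≤ s / P := by
    rw [div_le_div_iff₀ (by positivity) hP0]
    have hd3 : (1 : ℝ) ≤ d := hd'
    have h3 : (n : ℝ) * P ≤ P ^ 2 := by nlinarith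
    calc (n : ℝ) * P ≤ s * d ^ 2 * αD ^ 3 := hP2 ▸ h3
      _ ≤ s * d ^ 2 * αD ^ 3 * d := le_mul_of_one_le_right (by positivity) hd3
      _ = _ := by ring
  calc 200000 * Real.logb 2 n ^ 2 * n * (n / (αD * d) ^ 3 + √(n / (αD * d) ^ 3))
      ≤ 200000 * Real.logb 2 n ^ 2 * n * (s / P + s / P) := by gcongr
    _ = 400000 * n * Real.logb 2 n ^ 2 / P * s := by ring
    _ ≤ αS * s := by gcongr
end
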